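/- Let $R$ be a commutative noetherian local ring and $(A \xrightarrow{f} B)$ a monomorphism of finitely generated $R$-modules with cokernel $C$ and quotient map $g: B \to C$. Then for every $i \ge 0$ there exists a finitely generated projective $R$-module $Q$ such that the $i$-th syzygy in the morphism category satisfies $\Omega^i_{\mathcal{M}}(f) \cong (\Omega^i A \xrightarrow{[\Omega^i f \ \ e]} \Omega^i B \oplus Q)$, where $\Omega^i f$ is an induced map on minimal syzygies. -/

import Mathlib

open LinearMap Function

/-- A bundled module over a ring `S`. -/
structure Mdl (S : Type) [Ring S] : Type 1 where
  carrier : Type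
  [ag : AddCommGroup carrier]
  [mod : Module S carrier]

attribute [instance] Mdl.ag Mdl.mod

instance {S : Type} [Ring S] : CoeSort (Mdl S) Type := ⟨Mdl.carrier⟩

/-- Bundle a module. -/
def Mdl.of (S : Type) [Ring S] (M : Type) [AddCommGroup M] [Module S M] : Mdl S := ⟨M⟩

section RingDefs

variable {S : Type} [Ring S]

/-- finitely generated projective -/
def FGProj (P : Mdl S) : Prop := Module.Projective S P.carrier ∧ Module.Finite S P.carrier

/-- superfluous (small) submodule -/
def Superfluous {P : Type} [AddCommGroup P] [Module S P] (K : Submodule S P) : Prop :=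
  ∀ N : Submodule S P, N ⊔ K = ⊤ → N = ⊤

/-- projective cover of a module -/
def IsProjCover {P M : Mdl S} (p : P.carrier →ₗ[S] M.carrier) : Prop :=
  FGProj P ∧ Function.Surjective p ∧ Superfluous (LinearMap.ker p)

/-- `N` is a (minimal) first syzygy of `M`. -/
def IsSyz1 (M N : Mdl S) : Prop :=
  ∃ (P : Mdl S) (p : P.carrier →ₗ[S] M.carrier),
    IsProjCover p ∧ Nonempty (N.carrier ≃ₗ[S] LinearMap.ker p)

/-- `N` is an `n`-th (minimal) syzygy of `M`. -/
def IsSyz (n : ℕ) (M N : Mdl S) : Prop :=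
  ∃ F : Fin (n + 1) → Mdl S,
    Nonempty ((F 0).carrier ≃ₗ[S] M.carrier) ∧
    Nonempty ((F (Fin.last n)).carrier ≃ₗ[S] N.carrier) ∧
    ∀ i : Fin n, IsSyz1 (F i.castSucc) (F i.succ)

/-- Gorenstein projective: a syzygy of a totally acyclic complex of
finitely generated projectives. -/
def IsGP (M : Mdl S) : Prop :=
  ∃ (P : ℤ → Mdl S) (d : ∀ i : ℤ, (P (i + 1)).carrier →ₗ[S] (P i).carrier),
    (∀ i, FGProj (P i)) ∧
    (∀ i, LinearMap.range (d (i + 1)) = LinearMap.ker (d i)) ∧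
    (∀ (Q : Mdl S), Module.Projective S Q.carrier →
      ∀ (i : ℤ) (g : (P (i + 1)).carrier →ₗ[S] Q.carrier), g ∘ₗ d (i + 1) = 0 →
        ∃ h : (P i).carrier →ₗ[S] Q.carrier, h ∘ₗ d i = g) ∧
    Nonempty (M.carrier ≃ₗ[S] LinearMap.ker (d 0))

/-- a map factoring through a projective module -/
def FactorsThruProj {A B : Mdl S} (φ : A.carrier →ₗ[S] B.carrier) : Prop :=
  ∃ (Q : Mdl S) (α : A.carrier →ₗ[S] Q.carrier) (β : Q.carrier →ₗ[S] B.carrier),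
    Module.Projective S Q.carrier ∧ β ∘ₗ α = φ

/-- `M` is stable: it has no nonzero projective direct summand. -/
def NoProjSummand (M : Mdl S) : Prop :=
  ∀ N Q : Mdl S, Nonempty (M.carrier ≃ₗ[S] (N.carrier × Q.carrier)) →
    Module.Projective S Q.carrier → Subsingleton Q.carrier

/-- indecomposable module -/
def IndecMod (M : Mdl S) : Prop :=
  Nontrivial M.carrier ∧
  ∀ N Q : Mdl S, Nonempty (M.carrier ≃ₗ[S] (N.carrier × Q.carrier)) →
    Subsingleton N.carrier ∨ Subsingleton Q.carrier

end RingDefs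
section MorCat

variable {R : Type} [CommRing R]

/-- An object of the morphism category `𝓜`. -/
structure MObj (R : Type) [CommRing R] : Type 1 where
  dom : Mdl R
  cod : Mdl R
  map : dom.carrier →ₗ[R] cod.carrier

/-- A morphism in the morphism category: a commutative square. -/
structure MHom (f g : MObj R) : Type where
  h1 : f.dom.carrier →ₗ[R] g.dom.carrier
  h2 : f.cod.carrier →ₗ[R] g.cod.carrier
  comm : g.map ∘ₗ h1 = h2 ∘ₗ f.map

/-- isomorphism in the morphism category -/
def MIso (f g : MObj R) : Prop :=
  ∃ (e1 : f.dom.carrier ≃ₗ[R] g.dom.carrier) (e2 : f.cod.carrier ≃ₗ[R] g.cod.carrier),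
    g.map ∘ₗ (e1 : f.dom.carrier →ₗ[R] g.dom.carrier)
      = (e2 : f.cod.carrier →ₗ[R] g.cod.carrier) ∘ₗ f.map

/-- epimorphism in the morphism category (componentwise surjective) -/
def MEpi {f g : MObj R} (φ : MHom f g) : Prop :=
  Function.Surjective φ.h1 ∧ Function.Surjective φ.h2

/-- projective object of the morphism category -/
def MProj (f : MObj R) : Prop :=
  ∀ (g h : MObj R) (e : MHom g h), MEpi e → ∀ φ : MHom f h,
    ∃ ψ : MHom f g, e.h1 ∘ₗ ψ.h1 = φ.h1 ∧ e.h2 ∘ₗ ψ.h2 = φ.h2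

/-- projective cover in the morphism category: a right minimal epimorphism
from a projective object -/
def MProjCover {q f : MObj R} (φ : MHom q f) : Prop :=
  MProj q ∧ MEpi φ ∧
  ∀ ξ : MHom q q, φ.h1 ∘ₗ ξ.h1 = φ.h1 → φ.h2 ∘ₗ ξ.h2 = φ.h2 →
    Function.Bijective ξ.h1 ∧ Function.Bijective ξ.h2

/-- `g` is a first syzygy of `f` in the morphism category. -/
def MSyz1 (f g : MObj R) : Prop :=
  ∃ (q : MObj R) (φ : MHom q f), MProjCover φ ∧
    ∃ k : (LinearMap.ker φ.h1 : Type) →ₗ[R] (LinearMap.ker φ.h2 : Type),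
      (LinearMap.ker φ.h2).subtype ∘ₗ k = q.map ∘ₗ (LinearMap.ker φ.h1).subtype ∧
      MIso g ⟨Mdl.of R (LinearMap.ker φ.h1), Mdl.of R (LinearMap.ker φ.h2), k⟩

/-- `g` is an `n`-th syzygy of `f` in the morphism category. -/
def MSyz (n : ℕ) (f g : MObj R) : Prop :=
  ∃ F : Fin (n + 1) → MObj R,
    MIso (F 0) f ∧ MIso (F (Fin.last n)) g ∧
    ∀ i : Fin n, MSyz1 (F i.castSucc) (F i.succ)

/-- `g` is the induced map on (minimal) first syzygies of the map `f`. -/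
def MapSyz1 (f g : MObj R) : Prop :=
  ∃ (PA PB : Mdl R) (pA : PA.carrier →ₗ[R] f.dom.carrier)
    (pB : PB.carrier →ₗ[R] f.cod.carrier) (L : PA.carrier →ₗ[R] PB.carrier),
    IsProjCover pA ∧ IsProjCover pB ∧ f.map ∘ₗ pA = pB ∘ₗ L ∧
    ∃ k : (LinearMap.ker pA : Type) →ₗ[R] (LinearMap.ker pB : Type),
      (LinearMap.ker pB).subtype ∘ₗ k = L ∘ₗ (LinearMap.ker pA).subtype ∧
      MIso g ⟨Mdl.of R (LinearMap.ker pA), Mdl.of R (LinearMap.ker pB), k⟩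

/-- `g` is the induced map on minimal `n`-th syzygies of the map `f`. -/
def MapSyz (n : ℕ) (f g : MObj R) : Prop :=
  ∃ F : Fin (n + 1) → MObj R,
    MIso (F 0) f ∧ MIso (F (Fin.last n)) g ∧
    ∀ i : Fin n, MapSyz1 (F i.castSucc) (F i.succ)

/-- direct sum in the morphism category -/
def DSum (f g : MObj R) : MObj R :=
  ⟨Mdl.of R (f.dom.carrier × g.dom.carrier), Mdl.of R (f.cod.carrier × g.cod.carrier),
    f.map.prodMap g.map⟩

/-- the zero object, up to iso -/
def MTrivial (f : MObj R) : Prop := Subsingleton f.dom.carrier ∧ Subsingleton f.cod.carrier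

/-- indecomposable object of the morphism category -/
def MIndec (f : MObj R) : Prop :=
  ¬ MTrivial f ∧ ∀ g h : MObj R, MIso f (DSum g h) → MTrivial g ∨ MTrivial h

/-- the endomorphism ring of `f` in the morphism category is local -/
def MEndLocal (f : MObj R) : Prop :=
  ¬ MTrivial f ∧
  ∀ ξ : MHom f f,
    (Function.Bijective ξ.h1 ∧ Function.Bijective ξ.h2) ∨
    (Function.Bijective ((LinearMap.id : f.dom.carrier →ₗ[R] f.dom.carrier) - ξ.h1) ∧
     Function.Bijective ((LinearMap.id : f.cod.carrier →ₗ[R] f.cod.carrier) - ξ.h2))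

/-- no nonzero projective direct summand in the morphism category -/
def MNoProjSummand (f : MObj R) : Prop :=
  ∀ g q : MObj R, MIso f (DSum g q) → MProj q → MTrivial q

/-- the cokernel module of an object -/
def CokMod (f : MObj R) : Mdl R := Mdl.of R (f.cod.carrier ⧸ LinearMap.range f.map)

/-- the cokernel object `Cok(f) : B → Cok f` -/
def CokObj (f : MObj R) : MObj R := ⟨f.cod, CokMod f, (LinearMap.range f.map).mkQ⟩

/-- Gorenstein projective objects of the morphism category -/
def InG (f : MObj R) : Prop :=
  Function.Injective f.map ∧ IsGP f.dom ∧ IsGP (CokMod f)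

/-- objects of `𝓗`: morphisms between Gorenstein projective modules -/
def InH (f : MObj R) : Prop := IsGP f.dom ∧ IsGP f.cod

/-- objects of `𝓔`: epimorphisms between Gorenstein projective modules -/
def InE (f : MObj R) : Prop := InH f ∧ Function.Surjective f.map

/-- `𝓖`-precover -/
def IsGPrecover {g x : MObj R} (φ : MHom g x) : Prop :=
  InG g ∧ ∀ g' : MObj R, InG g' → ∀ ψ : MHom g' x,
    ∃ ξ : MHom g' g, φ.h1 ∘ₗ ξ.h1 = ψ.h1 ∧ φ.h2 ∘ₗ ξ.h2 = ψ.h2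

/-- right minimal morphism -/
def MRightMin {g x : MObj R} (φ : MHom g x) : Prop :=
  ∀ ξ : MHom g g, φ.h1 ∘ₗ ξ.h1 = φ.h1 → φ.h2 ∘ₗ ξ.h2 = φ.h2 →
    Function.Bijective ξ.h1 ∧ Function.Bijective ξ.h2

/-- `𝓖`-cover -/
def IsGCover {g x : MObj R} (φ : MHom g x) : Prop := IsGPrecover φ ∧ MRightMin φ

/-- `𝓔`-preenvelope -/
def IsEPreenvelope {x e : MObj R} (φ : MHom x e) : Prop :=
  InE e ∧ ∀ e' : MObj R, InE e' → ∀ ψ : MHom x e',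
    ∃ ξ : MHom e e', ξ.h1 ∘ₗ φ.h1 = ψ.h1 ∧ ξ.h2 ∘ₗ φ.h2 = ψ.h2

/-- left minimal morphism -/
def MLeftMin {x e : MObj R} (φ : MHom x e) : Prop :=
  ∀ ξ : MHom e e, ξ.h1 ∘ₗ φ.h1 = φ.h1 → ξ.h2 ∘ₗ φ.h2 = φ.h2 →
    Function.Bijective ξ.h1 ∧ Function.Bijective ξ.h2

/-- `𝓔`-envelope -/
def IsEEnvelope {x e : MObj R} (φ : MHom x e) : Prop := IsEPreenvelope φ ∧ MLeftMin φ

/-- injective objects of `𝓗`: sums of `(P → P)` and `(P → 0)`,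
i.e. objects isomorphic to a projection `P × P' → P`. -/
def HInj (q : MObj R) : Prop :=
  ∃ P P' : Mdl R, FGProj P ∧ FGProj P' ∧
    MIso q ⟨Mdl.of R (P.carrier × P'.carrier), P, LinearMap.fst R P.carrier P'.carrier⟩

/-- no nonzero `𝓗`-injective direct summand -/
def MNoHInjSummand (f : MObj R) : Prop :=
  ∀ g q : MObj R, MIso f (DSum g q) → HInj q → MTrivial q

/-- `s` is (isomorphic to) the reduced `𝓖`-cover of `x` -/
def IsRedGCover (s x : MObj R) : Prop :=
  ∃ (g : MObj R) (φ : MHom g x), IsGCover φ ∧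
    ∃ q : MObj R, MProj q ∧ MIso g (DSum s q) ∧ MNoProjSummand s

/-- `s` is (isomorphic to) the reduced `𝓔`-envelope of `x` -/
def IsRedEEnvelope (s x : MObj R) : Prop :=
  ∃ (e : MObj R) (φ : MHom x e), IsEEnvelope φ ∧
    ∃ q : MObj R, HInj q ∧ MIso e (DSum s q) ∧ MNoHInjSummand s

/-- Auslander transpose of a module -/
def IsTranspose (M T : Mdl R) : Prop :=
  ∃ (P1 P0 : Mdl R) (d : P1.carrier →ₗ[R] P0.carrier) (p : P0.carrier →ₗ[R] M.carrier),
    FGProj P1 ∧ FGProj P0 ∧ Function.Surjective p ∧ Superfluous (LinearMap.ker p) ∧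
    LinearMap.range d = LinearMap.ker p ∧ Superfluous (LinearMap.ker d) ∧
    Nonempty (T.carrier ≃ₗ[R] (Module.Dual R P1.carrier ⧸ LinearMap.range d.dualMap))

/-- `L` is `λ M = Ω¹ Tr M`. -/
def LambdaOf (M L : Mdl R) : Prop := ∃ T : Mdl R, IsTranspose M T ∧ IsSyz1 T L

/-- horizontally linked module -/
def HorLinkedMod (M : Mdl R) : Prop :=
  ∃ L L2 : Mdl R, LambdaOf M L ∧ LambdaOf L L2 ∧ Nonempty (M.carrier ≃ₗ[R] L2.carrier)

/-- the Auslander transpose in the morphism category, computed by dualizing a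
(componentwise) minimal projective presentation
`(P₁ → P₁ ⊕ Q₁) → (P₀ → P₀ ⊕ Q₀) → f → 0` in `𝓜` against `𝐫 = (R → R ⊕ R)`. -/
def IsMTranspose (f t : MObj R) : Prop :=
  ∃ (P1 Q1 P0 Q0 : Mdl R)
    (u : P1.carrier →ₗ[R] P0.carrier)
    (v : (P1.carrier × Q1.carrier) →ₗ[R] (P0.carrier × Q0.carrier))
    (p : P0.carrier →ₗ[R] f.dom.carrier)
    (q : (P0.carrier × Q0.carrier) →ₗ[R] f.cod.carrier),
    FGProj P1 ∧ FGProj Q1 ∧ FGProj P0 ∧ FGProj Q0 ∧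
    v ∘ₗ LinearMap.inl R P1.carrier Q1.carrier = LinearMap.inl R P0.carrier Q0.carrier ∘ₗ u ∧
    q ∘ₗ LinearMap.inl R P0.carrier Q0.carrier = f.map ∘ₗ p ∧
    Function.Surjective p ∧ Function.Surjective q ∧
    Superfluous (LinearMap.ker p) ∧ Superfluous (LinearMap.ker q) ∧
    LinearMap.range u = LinearMap.ker p ∧ LinearMap.range v = LinearMap.ker q ∧
    Superfluous (LinearMap.ker u) ∧ Superfluous (LinearMap.ker v) ∧
    ∃ (e1 : t.dom.carrier ≃ₗ[R]
        (Module.Dual R Q1.carrier ⧸ LinearMap.range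
          (LinearMap.snd R P0.carrier Q0.carrier ∘ₗ v ∘ₗ
            LinearMap.inr R P1.carrier Q1.carrier).dualMap))
      (e2 : t.cod.carrier ≃ₗ[R]
        (Module.Dual R (P1.carrier × Q1.carrier) ⧸ LinearMap.range v.dualMap))
      (tt : (Module.Dual R Q1.carrier ⧸ LinearMap.range
          (LinearMap.snd R P0.carrier Q0.carrier ∘ₗ v ∘ₗ
            LinearMap.inr R P1.carrier Q1.carrier).dualMap) →ₗ[R]
        (Module.Dual R (P1.carrier × Q1.carrier) ⧸ LinearMap.range v.dualMap)),
      tt ∘ₗ (LinearMap.range (LinearMap.snd R P0.carrier Q0.carrier ∘ₗ v ∘ₗ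
          LinearMap.inr R P1.carrier Q1.carrier).dualMap).mkQ
        = (LinearMap.range v.dualMap).mkQ ∘ₗ (LinearMap.snd R P1.carrier Q1.carrier).dualMap ∧
      (e2 : t.cod.carrier →ₗ[R] _) ∘ₗ t.map = tt ∘ₗ (e1 : t.dom.carrier →ₗ[R] _)

/-- `g ≅ λ_𝓜 f = Ω¹_𝓜 Tr_𝓜 f` -/
def MLambda (f g : MObj R) : Prop := ∃ t : MObj R, IsMTranspose f t ∧ MSyz1 t g

/-- horizontally linked object of the submodule category -/
def MHorLinked (f : MObj R) : Prop :=
  ∃ g h : MObj R, MLambda f g ∧ MLambda g h ∧ MIso f h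

/-- the dual object `(B' → A')` of `(A → B)` -/
def DualObj (f : MObj R) : MObj R :=
  ⟨Mdl.of R (Module.Dual R f.cod.carrier), Mdl.of R (Module.Dual R f.dom.carrier), f.map.dualMap⟩

/-- componentwise short exact sequence in the morphism category -/
def MShortExact {a b c : MObj R} (φ : MHom a b) (ψ : MHom b c) : Prop :=
  Function.Injective φ.h1 ∧ Function.Injective φ.h2 ∧
  Function.Surjective ψ.h1 ∧ Function.Surjective ψ.h2 ∧
  LinearMap.range φ.h1 = LinearMap.ker ψ.h1 ∧
  LinearMap.range φ.h2 = LinearMap.ker ψ.h2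

/-- split monomorphism -/
def MSplitMono {a b : MObj R} (φ : MHom a b) : Prop :=
  ∃ σ : MHom b a, σ.h1 ∘ₗ φ.h1 = LinearMap.id ∧ σ.h2 ∘ₗ φ.h2 = LinearMap.id

/-- split epimorphism -/
def MSplitEpi {x c : MObj R} (θ : MHom x c) : Prop :=
  ∃ σ : MHom c x, θ.h1 ∘ₗ σ.h1 = LinearMap.id ∧ θ.h2 ∘ₗ σ.h2 = LinearMap.id

/-- almost split sequence in a full subcategory `C` of the morphism category -/
def IsAlmostSplitIn (C : MObj R → Prop) {a b c : MObj R}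
    (φ : MHom a b) (ψ : MHom b c) : Prop :=
  C a ∧ C b ∧ C c ∧ MShortExact φ ψ ∧ ¬ MSplitMono φ ∧ MEndLocal a ∧
  ∀ x : MObj R, C x → ∀ θ : MHom x c, ¬ MSplitEpi θ →
    ∃ ρ : MHom x b, ψ.h1 ∘ₗ ρ.h1 = θ.h1 ∧ ψ.h2 ∘ₗ ρ.h2 = θ.h2

end MorCat

/-- A Gorenstein local ring: noetherian local, and some fixed syzygy functor lands in
Gorenstein projective (maximal Cohen-Macaulay) modules. -/
def IsGorensteinLocal (R : Type) [CommRing R] : Prop :=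
  IsNoetherianRing R ∧ IsLocalRing R ∧
  ∃ n : ℕ, ∀ M : Mdl R, Module.Finite R M.carrier → ∀ N : Mdl R, IsSyz n M N → IsGP N


theorem exists_projCover {R : Type} [CommRing R] [IsLocalRing R] (M : Mdl R)
    [Module.Finite R M.carrier] :
    ∃ (P : Mdl R) (p : P.carrier →ₗ[R] M.carrier), IsProjCover p := by
  classical
  have hex : ∃ n : ℕ, ∃ s : Finset M.carrier, Submodule.span R (s : Set M.carrier) = ⊤ ∧
      s.card = n := by
    obtain ⟨s, hs⟩ := (Module.Finite.fg_top : (⊤ : Submodule R M.carrier).FG)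
    exact ⟨_, s, hs, rfl⟩
  obtain ⟨s, hs, hcard⟩ := Nat.find_spec hex
  have hmin : ∀ i ∈ s, i ∉ Submodule.span R ((s.erase i : Finset M.carrier) : Set M.carrier) := by
    intro i hi hmem
    refine Nat.find_min hex (m := (s.erase i).card)
      (hcard ▸ Finset.card_erase_lt_of_mem hi) ⟨_, ?_, rfl⟩
    rw [eq_top_iff, ← hs, Submodule.span_le]
    intro j hj
    by_cases hji : j = i
    · exact hji ▸ hmem
    · exact Submodule.subset_span (Finset.mem_coe.2 (Finset.mem_erase.2 ⟨hji, hj⟩))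
  let p : (s → R) →ₗ[R] M.carrier := Fintype.linearCombination R (fun i : s => (i : M.carrier))
  have hker : LinearMap.ker p ≤ IsLocalRing.maximalIdeal R • (⊤ : Submodule R (s → R)) := by
    intro x hx
    have hxi : ∀ i, x i ∈ IsLocalRing.maximalIdeal R := by
      intro i
      by_contra hu
      rw [IsLocalRing.mem_maximalIdeal, mem_nonunits_iff, not_not] at hu
      apply hmin i i.2
      have h0 : ∑ j, x j • (j : M.carrier) = 0 := hx
      rw [← Finset.add_sum_erase _ _ (Finset.mem_univ i)] at h0
      rw [← Submodule.smul_mem_iff_of_isUnit _ hu, eq_neg_of_add_eq_zero_left h0]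
      refine Submodule.neg_mem _ (Submodule.sum_mem _ fun j hj => Submodule.smul_mem _ _ ?_)
      exact Submodule.subset_span (Finset.mem_coe.2 (Finset.mem_erase.2
        ⟨fun h => (Finset.mem_erase.1 hj).1 (Subtype.ext h), j.2⟩))
    rw [pi_eq_sum_univ x]
    exact Submodule.sum_mem _ fun i _ => Submodule.smul_mem_smul (hxi i) trivial
  have hsurj : Function.Surjective p := by
    rw [← LinearMap.range_eq_top]
    refine (Fintype.range_linearCombination R _).trans ?_
    simpa using hs
  have hsup : Superfluous (LinearMap.ker p) := fun N hN =>
    eq_top_iff.2 (Submodule.le_of_le_smul_of_le_jacobson_bot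
      (I := IsLocalRing.maximalIdeal R) Module.Finite.fg_top
      (by rw [IsLocalRing.jacobson_eq_maximalIdeal]; exact bot_ne_top)
      (hN.ge.trans (sup_le_sup_left hker N)))
  exact ⟨Mdl.of R (s → R), p, ⟨inferInstanceAs (Module.Projective R (s → R)),
    inferInstanceAs (Module.Finite R (s → R))⟩, hsurj, hsup⟩

section

variable {R : Type} [CommRing R]

theorem Superfluous.surjective_of_comp {X P M : Type} [AddCommGroup X] [Module R X]
    [AddCommGroup P] [Module R P] [AddCommGroup M] [Module R M] {p : P →ₗ[R] M}
    (hp : Superfluous (LinearMap.ker p)) (s : X →ₗ[R] P)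
    (hs : Function.Surjective (p ∘ₗ s)) : Function.Surjective s := by
  rw [← LinearMap.range_eq_top]
  refine hp _ (eq_top_iff.2 fun y _ => ?_)
  obtain ⟨x, hx⟩ := hs (p y)
  refine Submodule.mem_sup.2 ⟨s x, ⟨x, rfl⟩, y - s x, ?_, by abel⟩
  rw [LinearMap.mem_ker, map_sub, sub_eq_zero]
  exact hx.symm

theorem Superfluous.prodMap_id {P M Q : Type} [AddCommGroup P] [Module R P]
    [AddCommGroup M] [Module R M] [AddCommGroup Q] [Module R Q] {p : P →ₗ[R] M}
    (hp : Superfluous (LinearMap.ker p)) :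
    Superfluous (LinearMap.ker (p.prodMap (LinearMap.id : Q →ₗ[R] Q))) := by
  intro N hN
  have hk : ∀ z ∈ LinearMap.ker (p.prodMap (LinearMap.id : Q →ₗ[R] Q)), p z.1 = 0 ∧ z.2 = 0 :=
    fun z hz => ⟨congrArg Prod.fst (LinearMap.mem_ker.1 hz),
      congrArg Prod.snd (LinearMap.mem_ker.1 hz)⟩
  have key : N.comap (LinearMap.inl R P Q) = ⊤ := by
    refine hp _ (eq_top_iff.2 fun y _ => ?_)
    obtain ⟨a, ha, b, hb, hab⟩ := Submodule.mem_sup.1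
      (hN ▸ Submodule.mem_top : (y, (0 : Q)) ∈ N ⊔ _)
    have ha2 : a.2 = 0 := by simpa [(hk b hb).2] using congrArg Prod.snd hab
    refine Submodule.mem_sup.2 ⟨a.1, ?_, b.1, (hk b hb).1, congrArg Prod.fst hab⟩
    rw [Submodule.mem_comap, LinearMap.inl_apply, ← ha2]
    exact ha
  rw [eq_top_iff, ← hN]
  refine sup_le le_rfl fun z hz => ?_
  have hmem : z.1 ∈ N.comap (LinearMap.inl R P Q) := key ▸ Submodule.mem_top
  rw [Submodule.mem_comap, LinearMap.inl_apply, ← (hk z hz).2] at hmem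
  exact hmem

theorem IsProjCover.bijective_of_comp_eq {P M : Mdl R} {p : P.carrier →ₗ[R] M.carrier}
    (hp : IsProjCover p) (s : P.carrier →ₗ[R] P.carrier) (hs : p ∘ₗ s = p) :
    Function.Bijective s := by
  have := hp.1.2
  exact OrzechProperty.bijective_of_surjective_endomorphism s
    (hp.2.2.surjective_of_comp s (hs.symm ▸ hp.2.1))

/-- The kernel of a composite of a surjection `s` onto a projective module with `t` splits as
`ker t × ker s`. -/
theorem exists_ker_comp_equiv {X S M : Type} [AddCommGroup X] [Module R X]
    [AddCommGroup S] [Module R S] [AddCommGroup M] [Module R M] [Module.Projective R S]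
    (s : X →ₗ[R] S) (hs : Function.Surjective s) (t : S →ₗ[R] M) :
    ∃ e : LinearMap.ker (t ∘ₗ s) ≃ₗ[R] (LinearMap.ker t × LinearMap.ker s),
      ∀ z, ((e z).1 : S) = s z := by
  obtain ⟨σ, hσ⟩ := s.exists_rightInverse_of_surjective (LinearMap.range_eq_top.2 hs)
  have hσ' : ∀ y, s (σ y) = y := fun y => LinearMap.congr_fun hσ y
  let u : LinearMap.ker (t ∘ₗ s) →ₗ[R] LinearMap.ker t :=
    (s ∘ₗ (LinearMap.ker (t ∘ₗ s)).subtype).codRestrict _ fun z => z.2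
  let v : LinearMap.ker (t ∘ₗ s) →ₗ[R] LinearMap.ker s :=
    ((LinearMap.id - σ ∘ₗ s) ∘ₗ (LinearMap.ker (t ∘ₗ s)).subtype).codRestrict _
      fun z => by simp [hσ']
  refine ⟨LinearEquiv.ofBijective (u.prod v) ⟨?_, ?_⟩, fun z => rfl⟩
  · rw [← LinearMap.ker_eq_bot, LinearMap.ker_eq_bot']
    intro z hz
    have h1 : s z = 0 := congrArg Subtype.val (congrArg Prod.fst hz)
    have h2 : (z : X) - σ (s z) = 0 := congrArg Subtype.val (congrArg Prod.snd hz)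
    rw [h1, map_zero, sub_zero] at h2
    exact Subtype.ext h2
  · rintro ⟨⟨b, hb⟩, ⟨k, hk⟩⟩
    rw [LinearMap.mem_ker] at hb hk
    refine ⟨⟨σ b + k, by simp [hσ', hb, hk]⟩, Prod.ext (Subtype.ext ?_) (Subtype.ext ?_)⟩
    · change s (σ b + k) = b
      simp [hσ', hk]
    · change (σ b + k) - σ (s (σ b + k)) = k
      simp [hσ', hk]

theorem projective_ker {X S : Type} [AddCommGroup X] [Module R X]
    [AddCommGroup S] [Module R S] [Module.Projective R X] [Module.Projective R S]
    (s : X →ₗ[R] S) (hs : Function.Surjective s) : Module.Projective R (LinearMap.ker s) := by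
  obtain ⟨σ, hσ⟩ := s.exists_rightInverse_of_surjective (LinearMap.range_eq_top.2 hs)
  have hσ' : ∀ y, s (σ y) = y := fun y => LinearMap.congr_fun hσ y
  refine Module.Projective.of_split (LinearMap.ker s).subtype
    ((LinearMap.id - σ ∘ₗ s).codRestrict _ fun z => by simp [hσ']) ?_
  ext z
  simp

theorem MIso.refl (f : MObj R) : MIso f f :=
  ⟨LinearEquiv.refl R _, LinearEquiv.refl R _, rfl⟩

theorem MIso.symm {f g : MObj R} : MIso f g → MIso g f := by
  rintro ⟨e1, e2, h⟩
  refine ⟨e1.symm, e2.symm, LinearMap.ext fun x => e2.injective ?_⟩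
  simpa using (LinearMap.congr_fun h (e1.symm x)).symm

theorem MIso.trans {f g h : MObj R} : MIso f g → MIso g h → MIso f h := by
  rintro ⟨e1, e2, he⟩ ⟨e1', e2', he'⟩
  refine ⟨e1.trans e1', e2.trans e2', LinearMap.ext fun x => ?_⟩
  have h1 := LinearMap.congr_fun he x
  have h2 := LinearMap.congr_fun he' (e1 x)
  simp only [LinearMap.comp_apply, LinearEquiv.coe_coe] at h1 h2
  simp [h2, h1]

/-- The induced map on the kernels of the components of a morphism in `𝓜`. -/
def MHom.kerObj {q f : MObj R} (φ : MHom q f) : MObj R :=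
  ⟨Mdl.of R (LinearMap.ker φ.h1), Mdl.of R (LinearMap.ker φ.h2),
    q.map.restrict fun x hx => by
      have := LinearMap.congr_fun φ.comm x
      simp only [LinearMap.comp_apply] at this
      rw [LinearMap.mem_ker] at hx ⊢
      rw [← this, hx, map_zero]⟩

theorem mSyz1_iff {f g : MObj R} :
    MSyz1 f g ↔ ∃ (q : MObj R) (φ : MHom q f), MProjCover φ ∧ MIso g φ.kerObj := by
  constructor
  · rintro ⟨q, φ, hφ, k, hk, hg⟩
    refine ⟨q, φ, hφ, ?_⟩
    obtain rfl : k = φ.kerObj.map :=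
      LinearMap.ext fun x => Subtype.ext (LinearMap.congr_fun hk x)
    exact hg
  · rintro ⟨q, φ, hφ, hg⟩
    exact ⟨q, φ, hφ, φ.kerObj.map, rfl, hg⟩

theorem MProjCover.kerObj_iso {f f' q q' : MObj R} {φ : MHom q f} {φ' : MHom q' f'}
    (hφ : MProjCover φ) (hφ' : MProjCover φ') (hf : MIso f f') : MIso φ.kerObj φ'.kerObj := by
  obtain ⟨e1, e2, he⟩ := hf
  have he' : ∀ x, f'.map (e1 x) = e2 (f.map x) := LinearMap.congr_fun he
  have hc : ∀ x, f.map (φ.h1 x) = φ.h2 (q.map x) := LinearMap.congr_fun φ.comm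
  have hc' : ∀ x, f'.map (φ'.h1 x) = φ'.h2 (q'.map x) := LinearMap.congr_fun φ'.comm
  obtain ⟨u, hu1, hu2⟩ := hφ.1 q' f' φ' hφ'.2.1
    ⟨e1 ∘ₗ φ.h1, e2 ∘ₗ φ.h2, LinearMap.ext fun x => by simp [he', hc]⟩
  obtain ⟨v, hv1, hv2⟩ := hφ'.1 q f φ hφ.2.1
    ⟨e1.symm ∘ₗ φ'.h1, e2.symm ∘ₗ φ'.h2, LinearMap.ext fun x => e2.injective (by
      simp [← he', hc'])⟩
  have hu1 : ∀ x, φ'.h1 (u.h1 x) = e1 (φ.h1 x) := LinearMap.congr_fun hu1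
  have hu2 : ∀ x, φ'.h2 (u.h2 x) = e2 (φ.h2 x) := LinearMap.congr_fun hu2
  have hv1 : ∀ x, φ.h1 (v.h1 x) = e1.symm (φ'.h1 x) := LinearMap.congr_fun hv1
  have hv2 : ∀ x, φ.h2 (v.h2 x) = e2.symm (φ'.h2 x) := LinearMap.congr_fun hv2
  have huc : ∀ x, q'.map (u.h1 x) = u.h2 (q.map x) := LinearMap.congr_fun u.comm
  have hvc : ∀ x, q.map (v.h1 x) = v.h2 (q'.map x) := LinearMap.congr_fun v.comm
  obtain ⟨b1, b2⟩ := hφ.2.2 ⟨v.h1 ∘ₗ u.h1, v.h2 ∘ₗ u.h2, LinearMap.ext fun x => by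
    simp [huc, hvc]⟩ (LinearMap.ext fun x => by simp [hu1, hv1])
    (LinearMap.ext fun x => by simp [hu2, hv2])
  obtain ⟨c1, c2⟩ := hφ'.2.2 ⟨u.h1 ∘ₗ v.h1, u.h2 ∘ₗ v.h2, LinearMap.ext fun x => by
    simp [huc, hvc]⟩ (LinearMap.ext fun x => by simp [hu1, hv1])
    (LinearMap.ext fun x => by simp [hu2, hv2])
  let E1 := LinearEquiv.ofBijective u.h1 ⟨Function.Injective.of_comp b1.1,
    Function.Surjective.of_comp c1.2⟩
  let E2 := LinearEquiv.ofBijective u.h2 ⟨Function.Injective.of_comp b2.1,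
    Function.Surjective.of_comp c2.2⟩
  have m1 : (LinearMap.ker φ.h1).map (E1 : q.dom.carrier →ₗ[R] q'.dom.carrier)
      = LinearMap.ker φ'.h1 := by
    ext y
    obtain ⟨x, rfl⟩ := E1.surjective y
    have : φ'.h1 (E1 x) = e1 (φ.h1 x) := hu1 x
    simp [this]
  have m2 : (LinearMap.ker φ.h2).map (E2 : q.cod.carrier →ₗ[R] q'.cod.carrier)
      = LinearMap.ker φ'.h2 := by
    ext y
    obtain ⟨x, rfl⟩ := E2.surjective y
    have : φ'.h2 (E2 x) = e2 (φ.h2 x) := hu2 x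
    simp [this]
  exact ⟨E1.ofSubmodules _ _ m1, E2.ofSubmodules _ _ m2,
    LinearMap.ext fun (x : LinearMap.ker φ.h1) => Subtype.ext (huc x)⟩

/-- The morphism `(P → P × P') ⟶ f` of `𝓜` determined by maps `P → dom f` and `P' → cod f`. -/
def coverHom (f : MObj R) {P P' : Mdl R} (p : P.carrier →ₗ[R] f.dom.carrier)
    (l : P'.carrier →ₗ[R] f.cod.carrier) :
    MHom ⟨P, Mdl.of R (P.carrier × P'.carrier), LinearMap.inl R P.carrier P'.carrier⟩ f :=
  ⟨p, (f.map ∘ₗ p).coprod l, (LinearMap.coprod_inl _ _).symm⟩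

theorem mProj_inl {P P' : Mdl R} [Module.Projective R P.carrier]
    [Module.Projective R P'.carrier] :
    MProj (R := R)
      ⟨P, Mdl.of R (P.carrier × P'.carrier), LinearMap.inl R P.carrier P'.carrier⟩ := by
  intro g h e he φ
  obtain ⟨a, ha⟩ := Module.projective_lifting_property e.h1 φ.h1 he.1
  obtain ⟨b, hb⟩ := Module.projective_lifting_property e.h2
    (φ.h2 ∘ₗ LinearMap.inr R P.carrier P'.carrier) he.2
  refine ⟨⟨a, (g.map ∘ₗ a).coprod b, (LinearMap.coprod_inl _ _).symm⟩, ha, ?_⟩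
  have ha : ∀ x, e.h1 (a x) = φ.h1 x := LinearMap.congr_fun ha
  have hc : ∀ x, h.map (φ.h1 x) = φ.h2 (x, 0) := LinearMap.congr_fun φ.comm
  have hec : ∀ x, h.map (e.h1 x) = e.h2 (g.map x) := LinearMap.congr_fun e.comm
  have hb : ∀ x, e.h2 (b x) = φ.h2 (0, x) := LinearMap.congr_fun hb
  refine LinearMap.ext fun z => ?_
  obtain ⟨x, y⟩ := z
  change e.h2 (g.map (a x) + b y) = φ.h2 (x, y)
  rw [map_add, ← hec, ha, hc, hb]
  refine (map_add φ.h2 _ _).symm.trans (congrArg φ.h2 ?_)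
  exact Prod.ext (add_zero x) (zero_add y)

theorem mProjCover_coverHom (f : MObj R) {P P' : Mdl R} {p : P.carrier →ₗ[R] f.dom.carrier}
    (hp : IsProjCover p) {p' : P'.carrier →ₗ[R] (CokMod f).carrier} (hp' : IsProjCover p')
    {l : P'.carrier →ₗ[R] f.cod.carrier} (hl : (LinearMap.range f.map).mkQ ∘ₗ l = p') :
    MProjCover (coverHom f p l) := by
  have := hp.1.1
  have := hp'.1.1
  have hl' : ∀ y, (LinearMap.range f.map).mkQ (l y) = p' y := LinearMap.congr_fun hl
  refine ⟨mProj_inl, ⟨hp.2.1, fun b => ?_⟩, fun ξ h1 h2 => ?_⟩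
  · obtain ⟨y, hy⟩ := hp'.2.1 ((LinearMap.range f.map).mkQ b)
    have : b - l y ∈ LinearMap.range f.map := by
      rw [← Submodule.ker_mkQ (LinearMap.range f.map), LinearMap.mem_ker, map_sub, hl', hy]
      exact sub_self _
    obtain ⟨a, ha⟩ := this
    obtain ⟨x, rfl⟩ := hp.2.1 a
    refine ⟨(x, y), ?_⟩
    change f.map (p x) + l y = b
    rw [ha]
    abel
  · have b1 : Function.Bijective ξ.h1 := hp.bijective_of_comp_eq ξ.h1 h1
    have hc : ∀ x, ((ξ.h1 x, 0) : P.carrier × P'.carrier) = ξ.h2 (x, 0) :=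
      LinearMap.congr_fun ξ.comm
    have hq : ∀ z : P.carrier × P'.carrier,
        (LinearMap.range f.map).mkQ ((coverHom f p l).h2 z) = p' z.2 := by
      intro z
      change (LinearMap.range f.map).mkQ (f.map (p z.1) + l z.2) = p' z.2
      have h0 : (LinearMap.range f.map).mkQ (f.map (p z.1)) = 0 := by
        rw [← LinearMap.mem_ker, Submodule.ker_mkQ]
        exact ⟨_, rfl⟩
      rw [map_add, hl', h0]
      exact zero_add _
    let η : P'.carrier →ₗ[R] P'.carrier := LinearMap.snd R P.carrier P'.carrier ∘ₗ
      (ξ.h2 : (P.carrier × P'.carrier) →ₗ[R] (P.carrier × P'.carrier)) ∘ₗ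
      LinearMap.inr R P.carrier P'.carrier
    have b2 : Function.Bijective η := by
      refine hp'.bijective_of_comp_eq η (LinearMap.ext fun y => ?_)
      refine (hq (ξ.h2 (0, y))).symm.trans ?_
      have : (coverHom f p l).h2 (ξ.h2 (0, y)) = (coverHom f p l).h2 (0, y) :=
        LinearMap.congr_fun h2 (0, y)
      rw [this, hq]
    have hξ : ∀ z : P.carrier × P'.carrier,
        (ξ.h2 z : P.carrier × P'.carrier) =
          (ξ.h1 z.1 + (ξ.h2 (0, z.2) : P.carrier × P'.carrier).1, η z.2) := by
      intro z
      have hz : z = (z.1, 0) + (0, z.2) := by simp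
      have hz' : (ξ.h2 z : P.carrier × P'.carrier) = ξ.h2 (z.1, 0) + ξ.h2 (0, z.2) := by
        conv_lhs => rw [hz]
        exact map_add ξ.h2 _ _
      rw [hz', ← hc]
      exact Prod.ext rfl (zero_add _)
    refine ⟨b1, (injective_iff_map_eq_zero ξ.h2).2 fun z hz => ?_, fun w => ?_⟩
    · change P.carrier × P'.carrier at z
      obtain ⟨z1, z2⟩ := z
      have hz' := (hξ (z1, z2)).symm.trans hz
      obtain rfl : z2 = 0 := b2.1 ((congrArg Prod.snd hz').trans (map_zero η).symm)
      have h0 : ξ.h2 ((0, 0) : P.carrier × P'.carrier) = 0 := map_zero ξ.h2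
      have hz1 : ξ.h1 z1 + (ξ.h2 (0, 0) : P.carrier × P'.carrier).1 = 0 := congrArg Prod.fst hz'
      rw [h0] at hz1
      exact Prod.ext (b1.1 (((add_zero _).symm.trans hz1).trans (map_zero ξ.h1).symm)) rfl
    · change P.carrier × P'.carrier at w
      obtain ⟨y, hy⟩ := b2.2 w.2
      obtain ⟨x, hx⟩ := b1.2 (w.1 - (ξ.h2 (0, y) : P.carrier × P'.carrier).1)
      refine ⟨(x, y), (hξ (x, y)).trans (Prod.ext ?_ hy)⟩
      change ξ.h1 x + (ξ.h2 (0, y) : P.carrier × P'.carrier).1 = w.1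
      rw [hx]
      exact sub_add_cancel _ _

theorem exists_coverHom [IsLocalRing R] (f : MObj R) [Module.Finite R f.dom.carrier]
    [Module.Finite R f.cod.carrier] :
    ∃ (P P' : Mdl R) (p : P.carrier →ₗ[R] f.dom.carrier)
      (l : P'.carrier →ₗ[R] f.cod.carrier),
      IsProjCover p ∧ FGProj P' ∧ MProjCover (coverHom f p l) := by
  obtain ⟨P, p, hp⟩ := exists_projCover f.dom
  have : Module.Finite R (CokMod f).carrier :=
    inferInstanceAs (Module.Finite R (f.cod.carrier ⧸ LinearMap.range f.map))
  obtain ⟨P', p', hp'⟩ := exists_projCover (CokMod f)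
  have := hp'.1.1
  obtain ⟨l, hl⟩ := Module.projective_lifting_property (LinearMap.range f.map).mkQ p'
    (Submodule.mkQ_surjective _)
  exact ⟨P, P', p, l, hp, hp'.1, mProjCover_coverHom f hp hp' hl⟩

theorem exists_finite_mSyz1 [IsNoetherianRing R] [IsLocalRing R] (f : MObj R)
    [Module.Finite R f.dom.carrier] [Module.Finite R f.cod.carrier] :
    ∃ g : MObj R, MSyz1 f g ∧ Module.Finite R g.dom.carrier ∧ Module.Finite R g.cod.carrier := by
  obtain ⟨P, P', p, l, hp, hP', hc⟩ := exists_coverHom f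
  have := hp.1.2
  have := hP'.2
  exact ⟨(coverHom f p l).kerObj, mSyz1_iff.2 ⟨_, _, hc, MIso.refl _⟩,
    inferInstanceAs (Module.Finite R (LinearMap.ker p)),
    inferInstanceAs (Module.Finite R (LinearMap.ker ((f.map ∘ₗ p).coprod l)))⟩

/-- The object `(x.dom → x.cod ⊕ Q)` with components `x.map` and `e`. -/
abbrev MObj.extend (x : MObj R) (Q : Mdl R) (e : x.dom.carrier →ₗ[R] Q.carrier) : MObj R :=
  ⟨x.dom, Mdl.of R (x.cod.carrier × Q.carrier), LinearMap.prod x.map e⟩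

theorem exists_mapSyz1_of_mSyz1 [IsNoetherianRing R] [IsLocalRing R] {x h g : MObj R}
    [Module.Finite R x.dom.carrier] [Module.Finite R x.cod.carrier] {Q : Mdl R}
    {e : x.dom.carrier →ₗ[R] Q.carrier} (hQ : FGProj Q) (hh : MIso h (x.extend Q e))
    (hg : MSyz1 h g) :
    ∃ (x' : MObj R) (Q' : Mdl R) (e' : x'.dom.carrier →ₗ[R] Q'.carrier),
      Module.Finite R x'.dom.carrier ∧ Module.Finite R x'.cod.carrier ∧
      FGProj Q' ∧ MapSyz1 x x' ∧ MIso g (x'.extend Q' e') := by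
  obtain ⟨hQp, hQf⟩ := hQ
  have : Module.Finite R (x.extend Q e).dom.carrier :=
    inferInstanceAs (Module.Finite R x.dom.carrier)
  have : Module.Finite R (x.extend Q e).cod.carrier :=
    inferInstanceAs (Module.Finite R (x.cod.carrier × Q.carrier))
  obtain ⟨PA, PC, pA, l, hpA, ⟨hPC, hPC'⟩, hc⟩ := exists_coverHom (x.extend Q e)
  obtain ⟨q, φ, hφ, hgφ⟩ := mSyz1_iff.1 hg
  have hgc : MIso g (coverHom (x.extend Q e) pA l).kerObj := hgφ.trans (hφ.kerObj_iso hc hh)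
  obtain ⟨PB, pB, hpB⟩ := exists_projCover x.cod
  obtain ⟨hPA, hPA'⟩ := hpA.1
  obtain ⟨hPB, hPB'⟩ := hpB.1
  let t : (PB.carrier × Q.carrier) →ₗ[R] (x.cod.carrier × Q.carrier) :=
    pB.prodMap LinearMap.id
  let w : (PA.carrier × PC.carrier) →ₗ[R] (x.cod.carrier × Q.carrier) :=
    ((x.map.prod e) ∘ₗ pA).coprod l
  have hw : Function.Surjective w := hc.2.1.2
  obtain ⟨s, hs⟩ := Module.projective_lifting_property t w
    (Function.Surjective.prodMap hpB.2.1 Function.surjective_id)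
  have hss : Function.Surjective s :=
    (Superfluous.prodMap_id (Q := Q.carrier) hpB.2.2).surjective_of_comp s
      (by rw [show pB.prodMap LinearMap.id ∘ₗ s = w from hs]; exact hw)
  obtain ⟨E, hE⟩ := exists_ker_comp_equiv s hss t
  let L : PA.carrier →ₗ[R] PB.carrier :=
    LinearMap.fst R PB.carrier Q.carrier ∘ₗ s ∘ₗ LinearMap.inl R PA.carrier PC.carrier
  have hts : ∀ z, t (s z) = w z := LinearMap.congr_fun hs
  have hL : x.map ∘ₗ pA = pB ∘ₗ L := by
    ext a
    have h1 : pB (L a) = x.map (pA a) + (l 0).1 := congrArg Prod.fst (hts (a, 0))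
    rw [map_zero] at h1
    exact (h1.trans (add_zero _)).symm
  let k : MHom ⟨PA, PB, L⟩ x := ⟨pA, pB, hL⟩
  let T : LinearMap.ker t ≃ₗ[R] LinearMap.ker pB :=
    LinearEquiv.ofBijective
      (LinearMap.restrict (LinearMap.fst R PB.carrier Q.carrier) (p := LinearMap.ker t)
        (q := LinearMap.ker pB) fun z hz => congrArg Prod.fst (LinearMap.mem_ker.1 hz)) (by
      constructor
      · rintro ⟨a, ha⟩ ⟨b, hb⟩ hab
        have h1 : a.1 = b.1 := congrArg Subtype.val hab
        have ha2 : a.2 = 0 := congrArg Prod.snd (LinearMap.mem_ker.1 ha)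
        have hb2 : b.2 = 0 := congrArg Prod.snd (LinearMap.mem_ker.1 hb)
        exact Subtype.ext (Prod.ext h1 (ha2.trans hb2.symm))
      · rintro ⟨b, hb⟩
        exact ⟨⟨(b, 0), Prod.ext hb rfl⟩, rfl⟩)
  let W : LinearMap.ker w ≃ₗ[R] (LinearMap.ker pB × LinearMap.ker s) :=
    (LinearEquiv.ofEq _ _ (congrArg LinearMap.ker hs.symm)).trans
      (E.trans (T.prodCongr (LinearEquiv.refl R _)))
  let j : LinearMap.ker pA →ₗ[R] LinearMap.ker w :=
    (coverHom (x.extend Q e) pA l).kerObj.map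
  refine ⟨k.kerObj, Mdl.of R (LinearMap.ker s),
    LinearMap.snd R (LinearMap.ker pB) (LinearMap.ker s) ∘ₗ W.toLinearMap ∘ₗ j,
    inferInstanceAs (Module.Finite R (LinearMap.ker pA)),
    inferInstanceAs (Module.Finite R (LinearMap.ker pB)),
    ⟨projective_ker s hss, inferInstanceAs (Module.Finite R (LinearMap.ker s))⟩,
    ⟨PA, PB, pA, pB, L, hpA, hpB, hL, k.kerObj.map, rfl, MIso.refl _⟩, hgc.trans ?_⟩
  refine ⟨LinearEquiv.refl R _, W, LinearMap.ext fun a => Prod.ext (Subtype.ext ?_) rfl⟩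
  exact (congrArg Prod.fst
    (hE (LinearEquiv.ofEq _ _ (congrArg LinearMap.ker hs.symm) (j a)))).symm

/-- Extend a chain of related objects by one step. -/
theorem exists_chain_succ {r : MObj R → MObj R → Prop} {n : ℕ} {f g h : MObj R}
    (H : ∃ F : Fin (n + 1) → MObj R, F 0 = f ∧ F (Fin.last n) = g ∧
      ∀ i : Fin n, r (F i.castSucc) (F i.succ)) (hr : r g h) :
    ∃ F : Fin (n + 1 + 1) → MObj R, F 0 = f ∧ F (Fin.last (n + 1)) = h ∧
      ∀ i : Fin (n + 1), r (F i.castSucc) (F i.succ) := by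
  obtain ⟨F, h0, hl, hF⟩ := H
  refine ⟨Fin.snoc (α := fun _ => MObj R) F h, ?_, Fin.snoc_last _ _, fun i => ?_⟩
  · rw [← Fin.castSucc_zero, Fin.snoc_castSucc, h0]
  · rw [Fin.snoc_castSucc]
    induction i using Fin.lastCases with
    | last => rw [Fin.succ_last, Fin.snoc_last, hl]; exact hr
    | cast i => rw [Fin.succ_castSucc, Fin.snoc_castSucc]; exact hF i

theorem exists_mSyz_chain [IsNoetherianRing R] [IsLocalRing R] (f : MObj R)
    [Module.Finite R f.dom.carrier] [Module.Finite R f.cod.carrier] (n : ℕ) :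
    ∃ g : MObj R, Module.Finite R g.dom.carrier ∧ Module.Finite R g.cod.carrier ∧
      ∃ F : Fin (n + 1) → MObj R, F 0 = f ∧ F (Fin.last n) = g ∧
        ∀ i : Fin n, MSyz1 (F i.castSucc) (F i.succ) := by
  induction n with
  | zero => exact ⟨f, ‹_›, ‹_›, fun _ => f, rfl, rfl, fun i => i.elim0⟩
  | succ n ih =>
    obtain ⟨g, hg1, hg2, hF⟩ := ih
    obtain ⟨g', hg', h1, h2⟩ := exists_finite_mSyz1 g
    exact ⟨g', h1, h2, exists_chain_succ hF hg'⟩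

theorem exists_mapSyz_chain [IsNoetherianRing R] [IsLocalRing R] (f : MObj R)
    [Module.Finite R f.dom.carrier] [Module.Finite R f.cod.carrier] (n : ℕ)
    (F : Fin (n + 1) → MObj R) (h0 : MIso (F 0) f)
    (hF : ∀ i : Fin n, MSyz1 (F i.castSucc) (F i.succ)) :
    ∃ (x : MObj R) (Q : Mdl R) (e : x.dom.carrier →ₗ[R] Q.carrier),
      Module.Finite R x.dom.carrier ∧ Module.Finite R x.cod.carrier ∧ FGProj Q ∧
      (∃ G : Fin (n + 1) → MObj R, G 0 = f ∧ G (Fin.last n) = x ∧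
        ∀ i : Fin n, MapSyz1 (G i.castSucc) (G i.succ)) ∧
      MIso (F (Fin.last n)) (x.extend Q e) := by
  induction n with
  | zero =>
    refine ⟨f, Mdl.of R PUnit, 0, ‹_›, ‹_›, ⟨inferInstanceAs (Module.Projective R PUnit),
      inferInstanceAs (Module.Finite R PUnit)⟩, ⟨fun _ => f, rfl, rfl, fun i => i.elim0⟩,
      h0.trans ⟨LinearEquiv.refl R _, (LinearEquiv.prodUnique (M := f.cod.carrier)
        (M₂ := PUnit) (R := R)).symm, LinearMap.ext fun a => rfl⟩⟩
  | succ n ih =>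
    obtain ⟨x, Q, e, hx1, hx2, hQ, hG, hiso⟩ := ih (fun i => F i.castSucc) h0
      fun i => hF i.castSucc
    obtain ⟨x', Q', e', hx1', hx2', hQ', hm, hiso'⟩ :=
      exists_mapSyz1_of_mSyz1 hQ hiso (hF (Fin.last n))
    exact ⟨x', Q', e', hx1', hx2', hQ', exists_chain_succ hG hm, hiso'⟩

end

theorem statement5 (R : Type) [CommRing R] [IsNoetherianRing R] [IsLocalRing R]
    (f : MObj R) (h1 : Module.Finite R f.dom.carrier) (h2 : Module.Finite R f.cod.carrier)
    (hmono : Function.Injective f.map) (n : ℕ) :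
    (∃ g : MObj R, MSyz n f g) ∧
    ∀ g : MObj R, MSyz n f g →
      ∃ (x : MObj R) (Q : Mdl R) (e : x.dom.carrier →ₗ[R] Q.carrier),
        FGProj Q ∧ MapSyz n f x ∧
        MIso g ⟨x.dom, Mdl.of R (x.cod.carrier × Q.carrier), LinearMap.prod x.map e⟩ := by
  constructor
  · obtain ⟨g, _, _, F, h0, hl, hF⟩ := exists_mSyz_chain f n
    exact ⟨g, F, h0 ▸ MIso.refl _, hl ▸ MIso.refl _, hF⟩
  · rintro g ⟨F, h0, hl, hF⟩
    obtain ⟨x, Q, e, _, _, hQ, ⟨G, hG0, hGl, hG⟩, hiso⟩ := exists_mapSyz_chain f n F h0 hF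
    exact ⟨x, Q, e, hQ, ⟨G, hG0 ▸ MIso.refl _, hGl ▸ MIso.refl _, hG⟩, hl.symm.trans hiso⟩
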